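/- Let n ≥ 1 and l > 1 be integers and let p be the smallest prime divisor of l. If E_n(l) contains a nontrivial modular set, then l ≤ ( 2·(1 + l^{1/n − 1}) / (1 − √(1/3 + 2/(3p²))) )^n, where l^{1/n−1} denotes the real power. -/

import Mathlib

open Complex Filter Topology UpperHalfPlane Matrix MatrixGroups
open scoped Real Manifold

noncomputable section

/-- `B(x) = y² − y + 1/6` where `y` is the fractional part of `x`. -/
def bern (x : ℝ) : ℝ := Int.fract x ^ 2 - Int.fract x + 1 / 6

/-- The modular unit `[r]_l`. -/
def rl (l r : ℤ) : UpperHalfPlane → ℂ := fun z =>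
  Complex.exp (2 * (π : ℂ) * Complex.I *
      ((-((l : ℝ) * bern ((r : ℝ) / (l : ℝ)) / 2) : ℝ) : ℂ) * (z : ℂ)) *
    (∏' n : {n : ℤ // 0 < n ∧ n ≡ r [ZMOD l]},
      (1 - Complex.exp (2 * (π : ℂ) * Complex.I * ((n : ℤ) : ℂ) * (z : ℂ)))⁻¹) *
    (∏' n : {n : ℤ // 0 < n ∧ n ≡ -r [ZMOD l]},
      (1 - Complex.exp (2 * (π : ℂ) * Complex.I * ((n : ℤ) : ℂ) * (z : ℂ)))⁻¹)

/-- `E_n(l)`: the set of all products `[r₁,…,r_k]_l = ∏_j [r_j]_l` with `0 ≤ k ≤ n` and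
integers `r_j` not divisible by `l`. -/
def Enl (n l : ℕ) : Set (UpperHalfPlane → ℂ) :=
  {f | ∃ k : ℕ, k ≤ n ∧ ∃ r : Fin k → ℤ, (∀ j, ¬ (l : ℤ) ∣ r j) ∧
    f = fun z => ∏ j, rl l (r j) z}

/-- A modular set: a finite non-empty set of functions on `ℍ` whose (complex) span is
invariant under the action of `SL(2,ℤ)`. -/
def IsModularSet (S : Set (UpperHalfPlane → ℂ)) : Prop :=
  S.Finite ∧ S.Nonempty ∧
  ∀ A : SL(2, ℤ), ∀ f ∈ Submodule.span ℂ S, (fun z => f (A • z)) ∈ Submodule.span ℂ S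


lemma tprod_geom (a b : ℂ) (ha : ‖a‖ < 1) (hb : ‖b‖ < 1) :
    ∏' k : ℕ, (1 - a * b ^ k)⁻¹ = Complex.exp (∑' m : ℕ, (a ^ m / (1 - b ^ m)) / m) := by
  have hx : ∀ k : ℕ, ‖a * b ^ k‖ < 1 := by
    intro k
    rw [norm_mul, norm_pow]
    calc ‖a‖ * ‖b‖ ^ k ≤ ‖a‖ * 1 := by
          gcongr; exact pow_le_one₀ (norm_nonneg _) hb.le
      _ < 1 := by linarith
  have hlog : ∀ k : ℕ, HasSum (fun m : ℕ => (a * b ^ k) ^ m / m) (-Complex.log (1 - a * b ^ k)) :=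
    fun k => Complex.hasSum_taylorSeries_neg_log (hx k)
  have hsum : Summable (fun p : ℕ × ℕ => (a * b ^ p.1) ^ p.2 / (p.2 : ℂ)) := by
    have h1 : Summable (fun p : ℕ × ℕ => ‖b‖ ^ p.1 * ‖a‖ ^ p.2) :=
      (summable_geometric_of_lt_one (norm_nonneg _) hb).mul_of_nonneg
        (summable_geometric_of_lt_one (norm_nonneg _) ha)
        (fun _ => by positivity) (fun _ => by positivity)
    refine Summable.of_norm_bounded h1 ?_
    rintro ⟨k, m⟩
    rcases Nat.eq_zero_or_pos m with rfl | hm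
    · simp
    · have hm' : (1 : ℝ) ≤ m := by exact_mod_cast hm
      simp only [norm_div, norm_pow, norm_mul, Complex.norm_natCast]
      rw [mul_pow, ← pow_mul]
      calc ‖a‖ ^ m * ‖b‖ ^ (k * m) / m ≤ ‖a‖ ^ m * ‖b‖ ^ (k * m) :=
            div_le_self (by positivity) hm'
        _ ≤ ‖a‖ ^ m * ‖b‖ ^ k := by
            gcongr ?_ * ?_
            exact pow_le_pow_of_le_one (norm_nonneg _) hb.le (Nat.le_mul_of_pos_right k hm)
        _ = _ := mul_comm _ _
  have hne : ∀ k : ℕ, 1 - a * b ^ k ≠ 0 := by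
    intro k h0
    have := hx k
    rw [← sub_eq_zero.mp h0] at this
    simp at this
  have hlogsum : Summable (fun k : ℕ => -Complex.log (1 - a * b ^ k)) := by
    have := hsum.prod
    refine this.congr (fun k => ?_)
    exact ((hlog k).tsum_eq)
  have h2 : ∏' k : ℕ, (1 - a * b ^ k)⁻¹ = Complex.exp (∑' k : ℕ, -Complex.log (1 - a * b ^ k)) := by
    have := hlogsum.hasSum.cexp
    have h3 := this.tprod_eq
    rw [← h3]
    congr 1
    funext k
    simp [Complex.exp_neg, Complex.exp_log (hne k)]
  rw [h2]
  congr 1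
  calc ∑' k : ℕ, -Complex.log (1 - a * b ^ k) = ∑' k : ℕ, ∑' m : ℕ, (a * b ^ k) ^ m / m :=
        tsum_congr fun k => (hlog k).tsum_eq.symm
    _ = ∑' m : ℕ, ∑' k : ℕ, (a * b ^ k) ^ m / m := by
        exact (Summable.tsum_comm (f := fun m k : ℕ => (a * b ^ k) ^ m / (m : ℂ)) hsum.prod_symm)
    _ = _ := by
        refine tsum_congr fun m => ?_
        rcases Nat.eq_zero_or_pos m with rfl | hm
        · simp
        · have hbm : ‖b ^ m‖ < 1 := by
            rw [norm_pow]; exact pow_lt_one₀ (norm_nonneg _) hb hm.ne'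
          have : ∀ k : ℕ, (a * b ^ k) ^ m / (m : ℂ) = (a ^ m / m) * (b ^ m) ^ k := by
            intro k; rw [mul_pow, ← pow_mul, ← pow_mul, mul_comm k m]; ring
          simp_rw [this]
          rw [tsum_mul_left, tsum_geometric_of_norm_lt_one hbm]
          ring

def classEquiv (l : ℕ) (hl : 0 < l) (r : ℤ) (hr : ¬ (l : ℤ) ∣ r) :
    ℕ ≃ {n : ℤ // 0 < n ∧ n ≡ r [ZMOD l]} where
  toFun k := ⟨r % l + l * k, by
    have h1 := Int.emod_nonneg r (b := (l : ℤ)) (by omega)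
    have h2 : r % l ≠ 0 := fun h => hr (Int.dvd_of_emod_eq_zero h)
    constructor
    · have : (0 : ℤ) ≤ l * k := by positivity
      omega
    · simp [Int.ModEq]⟩
  invFun n := ((n : ℤ) / l).toNat
  left_inv k := by
    have h1 := Int.emod_nonneg r (b := (l : ℤ)) (by omega)
    have h2 := Int.emod_lt_of_pos r (b := (l : ℤ)) (by omega)
    have : (r % (l : ℤ) + l * k) / (l : ℤ) = k := by
      rw [Int.add_mul_ediv_left _ _ (by omega), Int.ediv_eq_zero_of_lt h1 h2]; simp
    simp [this]
  right_inv n := by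
    obtain ⟨n, hn, hnr⟩ := n
    apply Subtype.ext
    have h1 : 0 ≤ n / (l : ℤ) := Int.ediv_nonneg hn.le (by omega)
    simp only [Int.toNat_of_nonneg h1]
    rw [← hnr]
    exact Int.emod_add_mul_ediv n l

/-- the log-sum for one class -/
noncomputable def LS (l : ℕ) (s : ℤ) (w : ℂ) : ℂ :=
  ∑' m : ℕ, (Complex.exp (2 * π * Complex.I * s * w) ^ m / (1 - Complex.exp (2 * π * Complex.I * l * w) ^ m)) / m

lemma norm_exp_aux (s : ℝ) (w : ℂ) : ‖Complex.exp (2 * π * Complex.I * s * w)‖ = Real.exp (-(2 * π * s * w.im)) := by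
  rw [Complex.norm_exp]
  congr 1
  have : (2 * π * Complex.I * s * w : ℂ) = ((2 * π * s : ℝ) : ℂ) * (Complex.I * w) := by push_cast; ring
  rw [this, Complex.re_ofReal_mul]
  simp

lemma norm_exp_lt (s : ℝ) (hs : 0 < s) (w : ℂ) (hw : 0 < w.im) :
    ‖Complex.exp (2 * π * Complex.I * s * w)‖ < 1 := by
  rw [norm_exp_aux, Real.exp_lt_one_iff]
  have := Real.pi_pos
  have : 0 < 2 * π * s * w.im := by positivity
  linarith

lemma tprod_class (l : ℕ) (hl : 0 < l) (r : ℤ) (hr : ¬ (l : ℤ) ∣ r) (w : ℂ) (hw : 0 < w.im) :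
    (∏' n : {n : ℤ // 0 < n ∧ n ≡ r [ZMOD l]},
      (1 - Complex.exp (2 * (π : ℂ) * Complex.I * ((n : ℤ) : ℂ) * w))⁻¹) =
      Complex.exp (LS l (r % l) w) := by
  have h1 := Int.emod_nonneg r (b := (l : ℤ)) (by omega)
  have h2 : r % l ≠ 0 := fun h => hr (Int.dvd_of_emod_eq_zero h)
  have h3 : 0 < r % (l : ℤ) := by omega
  rw [← (classEquiv l hl r hr).tprod_eq, LS, ← tprod_geom]
  · refine tprod_congr fun k => ?_
    congr 2
    rw [← Complex.exp_nat_mul, ← Complex.exp_add]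
    congr 1
    simp only [classEquiv, Equiv.coe_fn_mk]
    push_cast
    ring
  · have := norm_exp_lt ((r % (l : ℤ) : ℤ) : ℝ) (by exact_mod_cast h3) w hw
    simpa using this
  · have := norm_exp_lt (l : ℝ) (by exact_mod_cast hl) w hw
    simpa using this

lemma LS_limit (l : ℕ) (hl : 0 < l) (s : ℤ) (hs : 0 < s) (α : ℝ) (N : ℤ) (hα : l * α = N)
    (w : ℝ → ℂ) (him : ∀ᶠ y in atTop, 0 < (w y).im) (hw : Tendsto w atTop (𝓝 (α : ℂ)))
    (hr : Tendsto (fun y => (w y - α) / ((w y).im : ℂ)) atTop (𝓝 Complex.I)) :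
    Tendsto (fun y => ((w y).im : ℂ) * LS l s (w y)) atTop
      (𝓝 (∑' m : ℕ, Complex.exp (2 * π * Complex.I * s * α) ^ m / (2 * π * l * m) / m)) := by
  have hpi := Real.pi_pos
  have hl1 : (1 : ℝ) ≤ l := by exact_mod_cast hl
  have hs1 : (1 : ℝ) ≤ s := by exact_mod_cast hs
  simp only [LS, ← tsum_mul_left]
  apply tendsto_tsum_of_dominated_convergence (bound := fun m : ℕ => 1 / (m : ℝ) ^ 2)
  · exact Real.summable_one_div_nat_pow.mpr (by norm_num)
  · intro m
    rcases Nat.eq_zero_or_pos m with rfl | hm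
    · simp
    have hm0 : (m : ℂ) ≠ 0 := by exact_mod_cast hm.ne'
    have hl0 : (l : ℂ) ≠ 0 := by exact_mod_cast hl.ne'
    have hpi0 : (π : ℂ) ≠ 0 := by exact_mod_cast hpi.ne'
    set κ : ℂ := 2 * π * Complex.I * l * m with hκ
    have hd : Tendsto (fun h : ℂ => h⁻¹ * (Complex.exp (κ * h) - 1)) (𝓝[≠] 0) (𝓝 κ) := by
      have h1 : HasDerivAt (fun h : ℂ => Complex.exp (κ * h)) κ 0 := by
        have := ((hasDerivAt_id (0 : ℂ)).const_mul κ).cexp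
        simpa using this
      have := h1.tendsto_slope_zero
      simpa using this
    have hh : Tendsto (fun y => w y - α) atTop (𝓝[≠] 0) := by
      rw [tendsto_nhdsWithin_iff]
      refine ⟨by simpa using hw.sub_const (α : ℂ), ?_⟩
      filter_upwards [him] with y hy h0
      have := congrArg Complex.im h0
      simp at this
      linarith
    have h3 := (((hd.comp hh).mul hr).inv₀ (by
      rw [hκ]
      simp [hm0, hl0, hpi0])).neg
    have h4 : Tendsto (fun y => Complex.exp (2 * π * Complex.I * s * w y) ^ m) atTop
        (𝓝 (Complex.exp (2 * π * Complex.I * s * α) ^ m)) :=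
      ((hw.const_mul _).cexp).pow m
    have h5 := (h4.mul h3).div_const (m : ℂ)
    have e : -(κ * Complex.I)⁻¹ = 1 / (2 * π * l * m) := by
      rw [hκ]
      have : (2 * π * Complex.I * l * m * Complex.I : ℂ) = -(2 * π * l * m) := by
        linear_combination (2 * π * l * m : ℂ) * Complex.I_mul_I
      rw [this, inv_neg, neg_neg, one_div]
    rw [e, mul_one_div] at h5
    refine h5.congr' ?_
    filter_upwards [him, hh.eventually self_mem_nhdsWithin] with y hy hy2
    have e2 : Complex.exp (2 * π * Complex.I * l * w y) ^ m = Complex.exp (κ * (w y - α)) := by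
      rw [← Complex.exp_nat_mul]
      have : (m : ℂ) * (2 * π * Complex.I * l * w y) = κ * (w y - α) + ((m * N : ℤ) : ℂ) * (2 * π * Complex.I) := by
        have hα' : (l : ℂ) * α = N := by exact_mod_cast hα
        push_cast
        rw [← hα', hκ]; ring
      rw [this, Complex.exp_add, Complex.exp_int_mul_two_pi_mul_I, mul_one]
    rw [e2]
    have hy' : ((w y).im : ℂ) ≠ 0 := by exact_mod_cast hy.ne'
    have hy3 : w y - α ≠ 0 := hy2
    simp only [Function.comp]
    have e3 : -((w y - ↑α)⁻¹ * (cexp (κ * (w y - ↑α)) - 1) * ((w y - ↑α) / ↑(w y).im))⁻¹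
       = (w y).im / (1 - cexp (κ * (w y - ↑α))) := by
      rw [show (w y - ↑α)⁻¹ * (cexp (κ * (w y - ↑α)) - 1) * ((w y - ↑α) / ↑(w y).im) =
        -((1 - cexp (κ * (w y - ↑α))) / (w y).im) by field_simp; ring]
      rw [inv_neg, neg_neg, inv_div]
    rw [e3]
    ring
  · filter_upwards [him] with y hy m
    rcases Nat.eq_zero_or_pos m with rfl | hm
    · simp
    have hm1 : (1 : ℝ) ≤ m := by exact_mod_cast hm
    set ε := (w y).im with hε
    set u := 2 * π * ε * m with hu
    have hu0 : 0 < u := by positivity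
    have n1 : ‖Complex.exp (2 * π * Complex.I * s * w y) ^ m‖ ≤ Real.exp (-u) := by
      have := norm_exp_aux (s : ℝ) (w y)
      rw [norm_pow]
      push_cast at this
      rw [this, ← Real.exp_nat_mul]
      apply Real.exp_le_exp.mpr
      have : u * 1 ≤ u * s := by gcongr
      rw [hu] at this ⊢
      rw [← hε]
      linarith
    have n2 : 1 - Real.exp (-u) ≤ ‖1 - Complex.exp (2 * π * Complex.I * l * w y) ^ m‖ := by
      have := norm_exp_aux (l : ℝ) (w y)
      push_cast at this
      have h6 : ‖Complex.exp (2 * π * Complex.I * l * w y) ^ m‖ ≤ Real.exp (-u) := by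
        rw [norm_pow, this, ← Real.exp_nat_mul]
        apply Real.exp_le_exp.mpr
        have : u * 1 ≤ u * l := by gcongr
        rw [hu] at this ⊢
        rw [← hε]
        linarith
      have h7 := norm_sub_norm_le (1 : ℂ) (Complex.exp (2 * π * Complex.I * l * w y) ^ m)
      simp only [norm_one] at h7
      linarith
    have n3 : u * Real.exp (-u) ≤ 1 - Real.exp (-u) := by
      have h8 := Real.add_one_le_exp u
      have h9 : Real.exp u * Real.exp (-u) = 1 := by rw [← Real.exp_add]; simp
      nlinarith [Real.exp_pos (-u)]
    have n4 : 0 < 1 - Real.exp (-u) := by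
      have := Real.exp_pos (-u)
      nlinarith
    have n5 : ‖Complex.exp (2 * π * Complex.I * s * w y) ^ m‖ / ‖1 - Complex.exp (2 * π * Complex.I * l * w y) ^ m‖ ≤ 1 / u := by
      rw [div_le_div_iff₀ (by linarith) hu0]
      nlinarith [Real.exp_pos (-u)]
    rw [norm_mul, norm_div, norm_div, Complex.norm_natCast, Complex.norm_real, Real.norm_of_nonneg hy.le]
    calc ε * (‖Complex.exp (2 * π * Complex.I * s * w y) ^ m‖ / ‖1 - Complex.exp (2 * π * Complex.I * l * w y) ^ m‖ / m)
        ≤ ε * (1 / u / m) := by gcongr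
      _ = (1 / (2 * π)) * (1 / (m : ℝ) ^ 2) := by rw [hu]; field_simp
      _ ≤ 1 * (1 / (m : ℝ) ^ 2) := by
          gcongr
          rw [div_le_one (by positivity)]
          linarith [Real.pi_gt_three]
      _ = _ := one_mul _

lemma bern_int_add (x : ℝ) (k : ℤ) : bern (x + k) = bern x := by
  simp [bern, Int.fract_add_intCast]

lemma bern_neg (x : ℝ) : bern (-x) = bern x := by
  unfold bern
  by_cases h : Int.fract x = 0
  · rw [Int.fract_neg_eq_zero.mpr h, h]
  · rw [Int.fract_neg h]; ring

lemma hasSum_bern (x : ℝ) :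
    HasSum (fun m : ℕ => 1 / (m : ℝ) ^ 2 * Real.cos (2 * π * m * x)) (π ^ 2 * bern x) := by
  have h := hasSum_one_div_nat_pow_mul_cos (k := 1) one_ne_zero (x := Int.fract x)
    ⟨Int.fract_nonneg x, (Int.fract_lt_one x).le⟩
  have e : (-1) ^ (1 + 1) * (2 * π) ^ (2 * 1) / 2 / ((2 * 1).factorial : ℝ) *
            Polynomial.eval (Int.fract x) (Polynomial.map (algebraMap ℚ ℝ) (Polynomial.bernoulli (2 * 1)))
      = π ^ 2 * bern x := by
    rw [Polynomial.bernoulli_def]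
    simp [Finset.sum_range_succ, bern, bernoulli_one, bernoulli_two, Nat.factorial]
    ring
  rw [e] at h
  refine h.congr_fun ?_
  intro m
  have : 2 * π * m * x = 2 * π * m * Int.fract x + ((m * ⌊x⌋ : ℤ) : ℝ) * (2 * π) := by
    conv_lhs => rw [← Int.floor_add_fract x]
    push_cast; ring
  rw [this, Real.cos_add_int_mul_two_pi]

lemma re_limit_sum (l : ℕ) (hl : 0 < l) (x : ℝ) :
    (∑' m : ℕ, Complex.exp (2 * π * Complex.I * x) ^ m / (2 * π * l * m) / m).re =
      π * bern x / (2 * l) := by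
  have hpi := Real.pi_pos
  have hl1 : (1 : ℝ) ≤ l := by exact_mod_cast hl
  have e : ∀ m : ℕ, Complex.exp (2 * π * Complex.I * x) ^ m / (2 * π * l * m) / m =
      ((1 / (2 * π * l) * (1 / (m : ℝ) ^ 2) : ℝ) : ℂ) * Complex.exp ((2 * π * m * x : ℝ) * Complex.I) := by
    intro m
    rw [← Complex.exp_nat_mul]
    rw [show (m : ℂ) * (2 * π * Complex.I * x) = (2 * π * m * x : ℝ) * Complex.I by push_cast; ring]
    push_cast
    ring
  simp_rw [e]
  have hs : Summable (fun m : ℕ => ((1 / (2 * π * l) * (1 / (m : ℝ) ^ 2) : ℝ) : ℂ) *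
      Complex.exp ((2 * π * m * x : ℝ) * Complex.I)) := by
    refine Summable.of_norm_bounded (g := fun m : ℕ => 1 / (2 * π * l) * (1 / (m : ℝ) ^ 2))
      ((Real.summable_one_div_nat_pow.mpr (by norm_num)).mul_left _) ?_
    intro m
    rw [norm_mul, Complex.norm_exp_ofReal_mul_I, mul_one, Complex.norm_real, Real.norm_of_nonneg (by positivity)]
  rw [Complex.re_tsum hs]
  have := ((hasSum_bern x).mul_left (1 / (2 * π * l))).tsum_eq
  rw [show π * bern x / (2 * l) = 1 / (2 * π * l) * (π ^ 2 * bern x) by field_simp, ← this]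
  refine tsum_congr fun m => ?_
  rw [Complex.re_ofReal_mul, Complex.exp_ofReal_mul_I_re]
  ring

lemma rl_eq_exp (l : ℕ) (hl : 0 < l) (r : ℤ) (hr : ¬ (l : ℤ) ∣ r) (w : UpperHalfPlane) :
    rl l r w = Complex.exp (2 * (π : ℂ) * Complex.I *
      ((-(((l : ℤ) : ℝ) * bern ((r : ℝ) / ((l : ℤ) : ℝ)) / 2) : ℝ) : ℂ) * (w : ℂ) +
        LS l (r % l) w + LS l ((-r) % l) w) := by
  rw [rl, tprod_class l hl r hr w w.im_pos, tprod_class l hl (-r) (by simpa using hr) w w.im_pos,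
    Complex.exp_add, Complex.exp_add]

lemma rl_limit (l : ℕ) (hl : 0 < l) (r : ℤ) (hr : ¬ (l : ℤ) ∣ r) (α : ℝ) (N : ℤ)
    (hα : l * α = N) (w : ℝ → UpperHalfPlane)
    (hw : Tendsto (fun y => (w y : ℂ)) atTop (𝓝 (α : ℂ)))
    (hra : Tendsto (fun y => ((w y : ℂ) - α) / ((w y).im : ℂ)) atTop (𝓝 Complex.I)) :
    Tendsto (fun y => (w y).im * Real.log ‖rl l r (w y)‖) atTop (𝓝 (π * bern (r * α) / l)) := by
  have key : ∀ r : ℤ, ¬ (l : ℤ) ∣ r → Tendsto (fun y => ((w y).im : ℂ) * LS l (r % l) (w y)) atTop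
      (𝓝 (∑' m : ℕ, Complex.exp (2 * π * Complex.I * ((((r % l : ℤ) : ℝ) * α : ℝ) : ℂ)) ^ m
        / (2 * π * l * m) / m)) := by
    intro r hr
    have h1 := Int.emod_nonneg r (b := (l : ℤ)) (by omega)
    have h2 : r % l ≠ 0 := fun h => hr (Int.dvd_of_emod_eq_zero h)
    have := LS_limit l hl (r % l) (by omega) α N hα (fun y => (w y : ℂ))
      (Eventually.of_forall fun y => (w y).im_pos) hw hra
    simpa [mul_assoc] using this
  have kb : ∀ r : ℤ, bern (((r % l : ℤ) : ℝ) * α) = bern (r * α) := by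
    intro r
    have : (r : ℝ) * α = ((r % l : ℤ) : ℝ) * α + ((N * (r / l) : ℤ) : ℝ) := by
      have h := congrArg (fun t : ℤ => (t : ℝ)) (Int.emod_add_mul_ediv r l)
      rw [← h]
      push_cast
      rw [← hα]
      ring
    rw [this, bern_int_add]
  have him : Tendsto (fun y => ((w y).im : ℝ)) atTop (𝓝 0) := by
    have := (Complex.continuous_im.tendsto _).comp hw
    rw [Complex.ofReal_im] at this
    exact this
  have him' : Tendsto (fun y => ((w y).im : ℂ)) atTop (𝓝 0) := by
    have := (Complex.continuous_ofReal.tendsto _).comp him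
    rw [Complex.ofReal_zero] at this
    exact this
  set c : ℂ := 2 * (π : ℂ) * Complex.I *
      ((-(((l : ℤ) : ℝ) * bern ((r : ℝ) / ((l : ℤ) : ℝ)) / 2) : ℝ) : ℂ) with hc
  have h3 := ((him'.mul (hw.const_mul c)).add (key r hr)).add (key (-r) (by simpa using hr))
  have h4 := (Complex.continuous_re.tendsto _).comp h3
  rw [zero_mul, zero_add, Complex.add_re, re_limit_sum l hl, re_limit_sum l hl, kb, kb] at h4
  have e : bern (((-r : ℤ) : ℝ) * α) = bern (r * α) := by
    rw [← bern_neg]; congr 1; push_cast; ring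
  rw [e] at h4
  have e2 : π * bern (r * α) / (2 * l) + π * bern (r * α) / (2 * l) = π * bern (r * α) / l := by
    have : (l : ℝ) ≠ 0 := by exact_mod_cast hl.ne'
    field_simp; ring
  rw [e2] at h4
  refine h4.congr fun y => ?_
  rw [rl_eq_exp l hl r hr, Complex.norm_exp, Real.log_exp]
  simp only [Function.comp]
  rw [← mul_add, ← mul_add, Complex.re_ofReal_mul]

/-- the point `i y` -/
def iy (y : ℝ) : UpperHalfPlane := if h : 0 < y then ⟨y * Complex.I, by simpa using h⟩ else UpperHalfPlane.I

lemma iy_coe (y : ℝ) (hy : 0 < y) : (iy y : ℂ) = y * Complex.I := by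
  simp [iy, hy]

lemma smul_iy (A : SL(2, ℤ)) (y : ℝ) (hy : 0 < y) :
    ((A • iy y : UpperHalfPlane) : ℂ) = (A 0 0 * (y * Complex.I) + A 0 1) / (A 1 0 * (y * Complex.I) + A 1 1) := by
  rw [UpperHalfPlane.specialLinearGroup_apply]
  simp [iy_coe y hy]

lemma rl_smul_limit (l : ℕ) (hl : 0 < l) (r : ℤ) (hr : ¬ (l : ℤ) ∣ r) (A : SL(2, ℤ))
    (hc : 0 < A 1 0) (N : ℤ) (hN : l * ((A 0 0 : ℝ) / A 1 0) = N) :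
    Tendsto (fun y => Real.log ‖rl l r (A • iy y)‖ / y) atTop
      (𝓝 (π * (A 1 0 : ℝ) ^ 2 * bern (r * ((A 0 0 : ℝ) / A 1 0)) / l)) := by
  set a := A 0 0 with ha
  set b := A 0 1
  set c := A 1 0 with hcdef
  set d := A 1 1
  have hdet : a * d - b * c = 1 := by
    have := A.det_coe
    rw [Matrix.det_fin_two] at this
    exact this
  have hdet' : (a : ℂ) * d - b * c = 1 := by exact_mod_cast hdet
  have hcR : (0 : ℝ) < c := by exact_mod_cast hc
  have hcC : (c : ℂ) ≠ 0 := by exact_mod_cast hc.ne'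
  have hden : ∀ y : ℝ, 0 < y → (c * (y * Complex.I) + d : ℂ) ≠ 0 := by
    intro y hy h
    have := congrArg Complex.im h
    simp at this
    rcases this with h | h
    · omega
    · linarith
  have hsub : ∀ y : ℝ, 0 < y → ((A • iy y : UpperHalfPlane) : ℂ) - ((a / c : ℝ) : ℂ) =
      -1 / (c * (c * (y * Complex.I) + d)) := by
    intro y hy
    rw [smul_iy A y hy]
    have := hden y hy
    push_cast
    change (a * (y * Complex.I) + b : ℂ) / (c * (y * Complex.I) + d) - a / c = _
    rw [div_sub_div _ _ this hcC, div_eq_div_iff (mul_ne_zero this hcC) (mul_ne_zero hcC this)]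
    linear_combination (-(c : ℂ) * (c * (y * Complex.I) + d)) * hdet'
  have hsub2 : ∀ y : ℝ, 0 < y → ((A • iy y : UpperHalfPlane) : ℂ) - ((a / c : ℝ) : ℂ) =
      ((1 / (c * (c ^ 2 * y ^ 2 + d ^ 2)) : ℝ) : ℂ) * (((-d : ℝ) : ℂ) + ((c * y : ℝ) : ℂ) * Complex.I) := by
    intro y hy
    have hp : (0 : ℝ) < c ^ 2 * y ^ 2 + d ^ 2 := by positivity
    have hp' : ((c : ℂ) ^ 2 * y ^ 2 + d ^ 2) ≠ 0 := by exact_mod_cast hp.ne'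
    rw [hsub y hy]
    push_cast
    rw [div_mul_eq_mul_div, div_eq_div_iff (mul_ne_zero hcC (hden y hy)) (mul_ne_zero hcC hp')]
    linear_combination (-(c : ℂ) ^ 3 * y ^ 2) * Complex.I_mul_I
  have him : ∀ y : ℝ, 0 < y → (A • iy y : UpperHalfPlane).im = y / (c ^ 2 * y ^ 2 + d ^ 2) := by
    intro y hy
    have h1 := congrArg Complex.im (hsub2 y hy)
    have hp : (0 : ℝ) < c ^ 2 * y ^ 2 + d ^ 2 := by positivity
    rw [Complex.im_ofReal_mul, Complex.sub_im, Complex.ofReal_im, sub_zero, Complex.add_im,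
      Complex.ofReal_im, Complex.im_ofReal_mul, Complex.I_im] at h1
    change ((A • iy y : UpperHalfPlane) : ℂ).im = _
    rw [h1]
    field_simp
    ring
  have hratio : ∀ y : ℝ, 0 < y → (((A • iy y : UpperHalfPlane) : ℂ) - ((a / c : ℝ) : ℂ)) /
      ((A • iy y : UpperHalfPlane).im : ℂ) = ((-d / c * y⁻¹ : ℝ) : ℂ) + Complex.I := by
    intro y hy
    have hp : (0 : ℝ) < c ^ 2 * y ^ 2 + d ^ 2 := by positivity
    have hp' : ((c : ℂ) ^ 2 * y ^ 2 + d ^ 2) ≠ 0 := by exact_mod_cast hp.ne'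
    have hy' : (y : ℂ) ≠ 0 := by exact_mod_cast hy.ne'
    rw [him y hy, hsub2 y hy]
    push_cast
    field_simp
  have hpos : ∀ᶠ y : ℝ in atTop, 0 < y := eventually_gt_atTop 0
  have l1 : Tendsto (fun y => (((A • iy y : UpperHalfPlane) : ℂ) - ((a / c : ℝ) : ℂ)) /
      ((A • iy y : UpperHalfPlane).im : ℂ)) atTop (𝓝 Complex.I) := by
    have h1 : Tendsto (fun y : ℝ => (-d / c * y⁻¹ : ℝ)) atTop (𝓝 0) := by
      simpa using tendsto_inv_atTop_zero.const_mul (-d / c : ℝ)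
    have h2 := ((Complex.continuous_ofReal.tendsto _).comp h1).add_const Complex.I
    simp only [Complex.ofReal_zero, zero_add] at h2
    refine h2.congr' ?_
    filter_upwards [hpos] with y hy
    rw [hratio y hy]
    rfl
  have l2 : Tendsto (fun y => (A • iy y : UpperHalfPlane).im * y) atTop (𝓝 (1 / (c : ℝ) ^ 2)) := by
    have h1 : Tendsto (fun y : ℝ => 1 / ((c : ℝ) ^ 2 + d ^ 2 * (y⁻¹ * y⁻¹))) atTop
        (𝓝 (1 / ((c : ℝ) ^ 2 + d ^ 2 * (0 * 0)))) := by
      apply Tendsto.div tendsto_const_nhds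
      · exact tendsto_const_nhds.add ((tendsto_inv_atTop_zero.mul tendsto_inv_atTop_zero).const_mul _)
      · positivity
    simp only [mul_zero, add_zero] at h1
    refine h1.congr' ?_
    filter_upwards [hpos] with y hy
    rw [him y hy]
    field_simp
  have l3 : Tendsto (fun y => (A • iy y : UpperHalfPlane).im) atTop (𝓝 0) := by
    have h1 := l2.mul tendsto_inv_atTop_zero
    rw [mul_zero] at h1
    refine h1.congr' ?_
    filter_upwards [hpos] with y hy
    field_simp
  have l4 : Tendsto (fun y => ((A • iy y : UpperHalfPlane) : ℂ)) atTop (𝓝 ((a / c : ℝ) : ℂ)) := by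
    have h1 := (l1.mul ((Complex.continuous_ofReal.tendsto _).comp l3)).add_const ((a / c : ℝ) : ℂ)
    rw [Complex.ofReal_zero, mul_zero, zero_add] at h1
    refine h1.congr fun y => ?_
    have : ((A • iy y : UpperHalfPlane).im : ℂ) ≠ 0 := by
      exact_mod_cast (A • iy y : UpperHalfPlane).im_pos.ne'
    simp only [Function.comp]
    rw [div_mul_cancel₀ _ this]
    ring
  have l5 := rl_limit l hl r hr (a / c) N hN (fun y => A • iy y) l4 l1
  have l6 := l5.div l2 (by positivity)
  have e : π * bern (r * (a / c)) / l / (1 / (c : ℝ) ^ 2) = π * (c : ℝ) ^ 2 * bern (r * (a / c)) / l := by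
    field_simp
  rw [e] at l6
  refine l6.congr fun y => ?_
  have : (A • iy y : UpperHalfPlane).im ≠ 0 := (A • iy y : UpperHalfPlane).im_pos.ne'
  exact mul_div_mul_left _ _ this

lemma rl_ne_zero (l : ℕ) (hl : 0 < l) (r : ℤ) (hr : ¬ (l : ℤ) ∣ r) (w : UpperHalfPlane) :
    rl l r w ≠ 0 := by
  rw [rl_eq_exp l hl r hr]; exact Complex.exp_ne_zero _

lemma prod_limit (l : ℕ) (hl : 0 < l) (k : ℕ) (r : Fin k → ℤ) (hr : ∀ j, ¬ (l : ℤ) ∣ r j)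
    (A : SL(2, ℤ)) (hc : 0 < A 1 0) (N : ℤ) (hN : l * ((A 0 0 : ℝ) / A 1 0) = N) :
    Tendsto (fun y => Real.log ‖∏ j, rl l (r j) (A • iy y)‖ / y) atTop
      (𝓝 (∑ j, π * (A 1 0 : ℝ) ^ 2 * bern (r j * ((A 0 0 : ℝ) / A 1 0)) / l)) := by
  have h := tendsto_finsetSum (Finset.univ : Finset (Fin k))
    (fun j _ => rl_smul_limit l hl (r j) (hr j) A hc N hN)
  refine h.congr fun y => ?_
  rw [norm_prod, Real.log_prod, Finset.sum_div]
  intro j _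
  exact norm_ne_zero_iff.mpr (rl_ne_zero l hl _ (hr j) _)

lemma upper_of_log {g : ℝ → ℂ} {L M : ℝ} (h : Tendsto (fun y => Real.log ‖g y‖ / y) atTop (𝓝 L))
    (hLM : L < M) : ∀ᶠ y in atTop, ‖g y‖ ≤ Real.exp (M * y) := by
  filter_upwards [h.eventually_lt_const hLM, eventually_gt_atTop 0] with y h1 h2
  rw [div_lt_iff₀ h2] at h1
  rcases eq_or_ne (g y) 0 with h0 | h0
  · rw [h0, norm_zero]; positivity
  · rw [← Real.log_le_iff_le_exp (norm_pos_iff.mpr h0)]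
    exact h1.le

lemma lower_of_log {g : ℝ → ℂ} {L M : ℝ} (h : Tendsto (fun y => Real.log ‖g y‖ / y) atTop (𝓝 L))
    (hg : ∀ y, g y ≠ 0) (hLM : M < L) : ∀ᶠ y in atTop, Real.exp (M * y) ≤ ‖g y‖ := by
  filter_upwards [h.eventually_const_lt hLM, eventually_gt_atTop 0] with y h1 h2
  rw [lt_div_iff₀ h2] at h1
  rw [← Real.le_log_iff_exp_le (norm_pos_iff.mpr (hg y))]
  exact h1.le

lemma span_upper (l : ℕ) (hl : 0 < l) (K : ℕ) (S : Set (UpperHalfPlane → ℂ)) (hS : S ⊆ Enl K l)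
    (M : ℝ) (hM : π * K / (6 * l) < M) (v : UpperHalfPlane → ℂ) (hv : v ∈ Submodule.span ℂ S) :
    ∃ C : ℝ, ∀ᶠ y in atTop, ‖v (ModularGroup.S • iy y)‖ ≤ C * Real.exp (M * y) := by
  have hpi := Real.pi_pos
  have hlR : (0 : ℝ) < l := by exact_mod_cast hl
  induction hv using Submodule.span_induction with
  | mem f hf =>
    obtain ⟨k, hk, r, hr, rfl⟩ := hS hf
    have h := prod_limit l hl k r hr ModularGroup.S (by simp [ModularGroup.S]) 0
      (by simp [ModularGroup.S])
    refine ⟨1, ?_⟩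
    simp only [one_mul]
    apply upper_of_log h
    refine lt_of_le_of_lt ?_ hM
    have : (k : ℝ) ≤ K := by exact_mod_cast hk
    simp [ModularGroup.S, bern]
    rw [show (k : ℝ) * (π * 6⁻¹ / l) = π * k / (6 * l) by field_simp]
    gcongr
  | zero => exact ⟨0, by simp⟩
  | add f g _ _ hf hg =>
    obtain ⟨C, hC⟩ := hf
    obtain ⟨D, hD⟩ := hg
    refine ⟨C + D, ?_⟩
    filter_upwards [hC, hD] with y h1 h2
    rw [Pi.add_apply, add_mul]
    exact (norm_add_le _ _).trans (add_le_add h1 h2)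
  | smul c f _ hf =>
    obtain ⟨C, hC⟩ := hf
    refine ⟨‖c‖ * C, ?_⟩
    filter_upwards [hC] with y h1
    rw [Pi.smul_apply, norm_smul, mul_assoc]
    gcongr

lemma bern_sum_le (l : ℕ) (hl : 0 < l) (K : ℕ) (S : Set (UpperHalfPlane → ℂ)) (hS : S ⊆ Enl K l)
    (hmod : ∀ A : SL(2, ℤ), ∀ f ∈ Submodule.span ℂ S, (fun z => f (A • z)) ∈ Submodule.span ℂ S)
    (r : Fin K → ℤ) (hr : ∀ j, ¬ (l : ℤ) ∣ r j) (hf : (fun z => ∏ j, rl l (r j) z) ∈ S)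
    (A : SL(2, ℤ)) (hc : 0 < A 1 0) (N : ℤ) (hN : l * ((A 0 0 : ℝ) / A 1 0) = N) :
    (A 1 0 : ℝ) ^ 2 * ∑ j, bern (r j * ((A 0 0 : ℝ) / A 1 0)) ≤ K / 6 := by
  have hpi := Real.pi_pos
  have hlR : (0 : ℝ) < l := by exact_mod_cast hl
  have hlim := prod_limit l hl K r hr A hc N hN
  set L := ∑ j, π * (A 1 0 : ℝ) ^ 2 * bern (r j * ((A 0 0 : ℝ) / A 1 0)) / l with hL
  have hLM : L ≤ π * K / (6 * l) := by
    by_contra! hlt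
    obtain ⟨M, hM1, hM2⟩ := exists_between hlt
    obtain ⟨M', hM3, hM4⟩ := exists_between hM2
    have hv := hmod ModularGroup.S⁻¹ _ (hmod A _ (Submodule.subset_span hf))
    obtain ⟨C, hC⟩ := span_upper l hl K S hS M hM1 _ hv
    have hlow := lower_of_log hlim
      (fun y => Finset.prod_ne_zero_iff.mpr fun j _ => rl_ne_zero l hl _ (hr j) _) hM4
    have ht : Tendsto (fun y : ℝ => Real.exp ((M' - M) * y)) atTop atTop :=
      Real.tendsto_exp_atTop.comp (tendsto_id.const_mul_atTop (by linarith))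
    obtain ⟨y, h1, h2, h3⟩ := (hC.and (hlow.and (ht.eventually_gt_atTop C))).exists
    simp only [inv_smul_smul] at h1
    have h4 := h2.trans h1
    have h5 : Real.exp (M' * y) = Real.exp ((M' - M) * y) * Real.exp (M * y) := by
      rw [← Real.exp_add]; ring_nf
    rw [h5] at h4
    have := le_of_mul_le_mul_right h4 (Real.exp_pos _)
    linarith
  have e : L = (π / l) * ((A 1 0 : ℝ) ^ 2 * ∑ j, bern (r j * ((A 0 0 : ℝ) / A 1 0))) := by
    rw [hL, Finset.mul_sum, Finset.mul_sum]
    exact Finset.sum_congr rfl fun j _ => by ring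
  rw [e, show π * K / (6 * l) = (π / l) * (K / 6) by field_simp] at hLM
  exact le_of_mul_le_mul_left hLM (by positivity)

lemma dirichlet (l k : ℕ) (hl : 1 < l) (hk : 1 ≤ k) (r : Fin k → ℤ) :
    ∃ a : ℤ, ¬ (l : ℤ) ∣ a ∧ ∀ j, ∃ u N : ℤ, a * r j = u + l * N ∧
      (|u| : ℝ) ≤ (l : ℝ) ^ (1 - 1 / (k : ℝ)) := by
  have hlR : (1 : ℝ) < l := by exact_mod_cast hl
  have hkR : (1 : ℝ) ≤ k := by exact_mod_cast hk
  haveI : NeZero l := ⟨by omega⟩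
  set X := (l : ℝ) ^ (1 - 1 / (k : ℝ)) with hX
  have hX0 : 0 ≤ X := by positivity
  have hXl : X < l := by
    conv_rhs => rw [← Real.rpow_one (l : ℝ)]
    apply Real.rpow_lt_rpow_of_exponent_lt hlR
    have : 0 < 1 / (k : ℝ) := by positivity
    linarith
  set s := ⌊X⌋₊ + 1 with hs
  have hsX : X < s := by push_cast [hs]; exact Nat.lt_floor_add_one X
  have hsl : s ≤ l := by
    have : ⌊X⌋₊ < l := (Nat.floor_lt hX0).mpr hXl
    omega
  have hXk : X ^ k * l = (l : ℝ) ^ k := by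
    rw [hX, ← Real.rpow_natCast, ← Real.rpow_mul (by positivity)]
    rw [show (1 - 1 / (k : ℝ)) * k = k - 1 by field_simp]
    rw [Real.rpow_sub_one (by positivity), Real.rpow_natCast]
    field_simp
  have hcard : Fintype.card (Fin k → ZMod l) < Fintype.card (Fin l × (Fin k → Fin s)) := by
    simp only [Fintype.card_pi, ZMod.card, Finset.prod_const, Finset.card_univ, Fintype.card_fin,
      Fintype.card_prod]
    have : (l : ℝ) ^ k < l * (s : ℝ) ^ k := by
      rw [← hXk, mul_comm]
      gcongr
    exact_mod_cast this
  obtain ⟨⟨a, u⟩, ⟨b, v⟩, hne, heq⟩ := Fintype.exists_ne_map_eq_of_card_lt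
    (fun p : Fin l × (Fin k → Fin s) => fun j : Fin k =>
      ((((p.1 : ℕ) : ℤ) * r j - ((p.2 j : ℕ) : ℤ) : ℤ) : ZMod l)) hcard
  have hj : ∀ j, (l : ℤ) ∣ (((b : ℕ) : ℤ) * r j - ((v j : ℕ) : ℤ)) - (((a : ℕ) : ℤ) * r j - ((u j : ℕ) : ℤ)) := by
    intro j
    have := congrFun heq j
    exact (ZMod.intCast_eq_intCast_iff_dvd_sub _ _ _).mp this
  refine ⟨(b : ℕ) - (a : ℕ), ?_, ?_⟩
  · intro hd
    have hab : a = b := by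
      have h1 := a.2
      have h2 := b.2
      have h3 : ((b : ℕ) : ℤ) - (a : ℕ) = 0 := by
        apply Int.eq_zero_of_abs_lt_dvd hd
        rw [abs_lt]; constructor <;> omega
      ext; omega
    apply hne
    subst hab
    congr 1
    funext j
    have h1 := (u j).2
    have h2 := (v j).2
    have h3 : ((u j : ℕ) : ℤ) - (v j : ℕ) = 0 := by
      have := hj j
      rw [show ∀ x y z : ℤ, x - y - (x - z) = z - y by intros; ring] at this
      apply Int.eq_zero_of_abs_lt_dvd this
      rw [abs_lt]; constructor <;> omega
    ext; omega
  · intro j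
    obtain ⟨N, hN⟩ := hj j
    refine ⟨((v j : ℕ) : ℤ) - (u j : ℕ), N, by linarith, ?_⟩
    have h1 := (u j).2
    have h2 := (v j).2
    have h3 : |((v j : ℕ) : ℤ) - (u j : ℕ)| ≤ (⌊X⌋₊ : ℤ) := by
      rw [abs_le]; constructor <;> omega
    have h4 : ((|((v j : ℕ) : ℤ) - (u j : ℕ)| : ℤ) : ℝ) ≤ (⌊X⌋₊ : ℝ) := by exact_mod_cast h3
    push_cast at h4 ⊢
    exact h4.trans (Nat.floor_le hX0)

/-- Theorem (refined bound): if `E_n(l)` (with `l > 1`) contains a nontrivial modular set and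
`p` is the smallest prime divisor of `l`, then
`l ≤ (2(1 + l^{1/n − 1}) / (1 − √(1/3 + 2/(3p²))))^n`. -/
theorem sl2z_invariant_units_stmt5 (n l : ℕ) (hn : 1 ≤ n) (hl : 1 < l)
    (h : ∃ S : Set (UpperHalfPlane → ℂ),
      S ⊆ Enl n l ∧ IsModularSet S ∧ ∃ f ∈ S, f ≠ fun _ => 1) :
    (l : ℝ) ≤ ((2 * (1 + (l : ℝ) ^ ((1 : ℝ) / n - 1))) /
      (1 - Real.sqrt (1 / 3 + 2 / (3 * (l.minFac : ℝ) ^ 2)))) ^ n := by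
  obtain ⟨S, hSE, ⟨hfin, hne, hmod⟩, f, hfS, hf1⟩ := h
  have hl0 : 0 < l := by omega
  have hlR : (1 : ℝ) < l := by exact_mod_cast hl
  have hSE' : ∀ f, f ∈ S → ∃ k : ℕ, k ≤ n ∧ ∃ r : Fin k → ℤ, (∀ j, ¬ (l : ℤ) ∣ r j) ∧
    f = fun z => ∏ j, rl l (r j) z := fun f hf => hSE hf
  choose! k hkn r hr hfr using hSE'
  obtain ⟨f0, hf0, hmax⟩ := Set.exists_max_image S k hfin hne
  have hK1 : 1 ≤ k f0 := by
    have h1 := hmax f hfS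
    by_contra! h0
    have hk0 : k f = 0 := by omega
    apply hf1
    rw [hfr f hfS]
    funext z
    have : IsEmpty (Fin (k f)) := by rw [hk0]; infer_instance
    exact Finset.prod_of_isEmpty _
  have hSK : S ⊆ Enl (k f0) l := fun g hg => ⟨k g, hmax g hg, r g, hr g hg, hfr g hg⟩
  obtain ⟨a, hla, ha⟩ := dirichlet l (k f0) hl hK1 (r f0)
  set q : ℚ := (a : ℚ) / (l : ℤ) with hq
  have hqR : (q.num : ℝ) / (q.den : ℝ) = a / l := by
    have h1 : ((q : ℚ) : ℝ) = a / l := by rw [hq]; push_cast; rfl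
    rw [← h1]; exact (Rat.cast_def q).symm
  have hdvd : q.den ∣ l := by
    have := Rat.den_dvd a (l : ℤ)
    have e : q = Rat.divInt a (l : ℤ) := by rw [Rat.divInt_eq_div]
    rw [e]
    exact_mod_cast this
  have hden1 : q.den ≠ 1 := by
    intro h1
    apply hla
    have h2 : (q.num : ℝ) = a / l := by rw [← hqR, h1]; simp
    have h3 : (a : ℝ) = l * q.num := by rw [h2]; field_simp
    exact ⟨q.num, by exact_mod_cast h3⟩
  have hden2 : 2 ≤ q.den := by have := q.den_pos; omega
  have hple : l.minFac ≤ q.den := Nat.minFac_le_of_dvd hden2 hdvd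
  obtain ⟨A, hA0, hA1⟩ := (Rat.isCoprime_num_den q).exists_SL2_col 0
  have hcusp : ((A 0 0 : ℤ) : ℝ) / ((A 1 0 : ℤ) : ℝ) = a / l := by
    rw [hA0, hA1, ← hqR]; simp
  have hb := bern_sum_le l hl0 (k f0) S hSK hmod (r f0) (hr f0 hf0) (by rw [← hfr f0 hf0]; exact hf0) A
    (by rw [hA1]; exact_mod_cast q.den_pos) a (by rw [hcusp]; field_simp)
  rw [hcusp, hA1] at hb
  set p : ℝ := (l.minFac : ℝ) with hp
  have hp2 : 2 ≤ p := by
    rw [hp]; exact_mod_cast (Nat.minFac_prime (by omega)).two_le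
  have ht : p ≤ (q.den : ℝ) := by rw [hp]; exact_mod_cast hple
  -- some coordinate has small Bernoulli value
  have hex : ∃ j, bern (r f0 j * (a / l)) ≤ 1 / (6 * p ^ 2) := by
    by_contra! hall
    have hK1R : (1 : ℝ) ≤ k f0 := by exact_mod_cast hK1
    haveI : Nonempty (Fin (k f0)) := ⟨⟨0, hK1⟩⟩
    have h1 : ∑ j : Fin (k f0), 1 / (6 * p ^ 2) < ∑ j, bern (r f0 j * (a / l)) :=
      Finset.sum_lt_sum_of_nonempty Finset.univ_nonempty fun j _ => hall j
    simp only [Finset.sum_const, Finset.card_univ, Fintype.card_fin, nsmul_eq_mul] at h1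
    have h2 : p ^ 2 * ((k f0) * (1 / (6 * p ^ 2))) = (k f0 : ℝ) / 6 := by field_simp
    have h3 : p ^ 2 ≤ (q.den : ℝ) ^ 2 := by gcongr
    have h4 : (0 : ℝ) < (k f0) * (1 / (6 * p ^ 2)) := by positivity
    push_cast at hb
    have h5 := mul_le_mul_of_nonneg_right h3 h4.le
    have h6 : (0 : ℝ) < (q.den : ℝ) ^ 2 := by positivity
    have h7 := mul_lt_mul_of_pos_left h1 h6
    linarith
  obtain ⟨j, hj⟩ := hex
  obtain ⟨u, N, huN, hu⟩ := ha j
  set K : ℝ := (k f0 : ℝ) with hK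
  have hK1R : (1 : ℝ) ≤ K := by rw [hK]; exact_mod_cast hK1
  have hKn : K ≤ n := by rw [hK]; exact_mod_cast hkn f0 hf0
  set x : ℝ := |(u : ℝ)| / l with hx
  have hx0 : 0 ≤ x := by positivity
  have hxle : x ≤ (l : ℝ) ^ (-(1 / (n : ℝ))) := by
    have h1 : x ≤ (l : ℝ) ^ (1 - 1 / K) / l := by rw [hx]; gcongr
    have h2 : (l : ℝ) ^ (1 - 1 / K) / l = (l : ℝ) ^ (-(1 / K)) := by
      rw [← Real.rpow_sub_one (by positivity)]; congr 1; ring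
    rw [h2] at h1
    refine h1.trans ?_
    apply Real.rpow_le_rpow_of_exponent_le hlR.le
    have : 1 / (n : ℝ) ≤ 1 / K := by gcongr
    linarith
  have hnR : (1 : ℝ) ≤ n := by exact_mod_cast hn
  have hx1 : x < 1 := by
    refine hxle.trans_lt ?_
    apply Real.rpow_lt_one_of_one_lt_of_neg hlR
    have : 0 < 1 / (n : ℝ) := by positivity
    linarith
  have hbx : bern (r f0 j * (a / l)) = x ^ 2 - x + 1 / 6 := by
    have e1 : (r f0 j : ℝ) * (a / l) = (u : ℝ) / l + N := by
      have : (a : ℝ) * r f0 j = u + l * N := by exact_mod_cast huN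
      field_simp
      linarith
    rw [e1, bern_int_add]
    have e2 : bern ((u : ℝ) / l) = bern x := by
      rcases abs_cases (u : ℝ) with h | h
      · rw [hx, h.1]
      · rw [hx, h.1, neg_div, bern_neg]
    rw [e2, bern, Int.fract_eq_self.mpr ⟨hx0, hx1⟩]
  rw [hbx] at hj
  set R := Real.sqrt (1 / 3 + 2 / (3 * p ^ 2)) with hR
  have hR1 : R < 1 := by
    rw [hR, Real.sqrt_lt' one_pos]
    have : 2 / (3 * p ^ 2) ≤ 2 / (3 * 2 ^ 2) := by gcongr
    norm_num at this ⊢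
    linarith
  have hδ : (1 - R) / 2 ≤ x := by
    have h1 : 1 - 2 * x ≤ R := by
      apply Real.le_sqrt_of_sq_le
      have : 2 / (3 * p ^ 2) = 4 * (1 / (6 * p ^ 2)) := by field_simp; norm_num
      rw [this]
      nlinarith
    linarith
  have hfin1 : (l : ℝ) ^ (1 / (n : ℝ)) ≤ 2 / (1 - R) := by
    have h1 := hδ.trans hxle
    rw [Real.rpow_neg (by positivity)] at h1
    have h2 : 0 < (l : ℝ) ^ (1 / (n : ℝ)) := by positivity
    rw [le_div_iff₀ (by linarith)]
    have h3 := mul_le_mul_of_nonneg_left h1 h2.le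
    rw [mul_inv_cancel₀ h2.ne'] at h3
    linarith
  calc (l : ℝ) = ((l : ℝ) ^ (1 / (n : ℝ))) ^ n := by
        rw [← Real.rpow_natCast, ← Real.rpow_mul (by positivity)]
        rw [one_div_mul_cancel (by positivity), Real.rpow_one]
    _ ≤ (2 / (1 - R)) ^ n := by gcongr
    _ ≤ _ := by
        have h1 : 0 < (l : ℝ) ^ ((1 : ℝ) / n - 1) := by positivity
        have h2 : 0 < 1 - R := by linarith
        gcongr
        linarith
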